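/- arXiv:1408.3187 — 2 statements merged into one kernel-verified Lean document; each statement's English description precedes it below -/
import Mathlib

section
/- Let μ ∈ (0,1) and ξ = (√(1−μ²), 0, …, 0) ∈ ℝ^N (so μ² + |ξ|² = 1). Suppose h : ℝ^N → ℝ is measurable, satisfies the Kelvin relation h(y) = |y|^{−(N+2s)} h(y/|y|²) for almost every y ≠ 0, satisfies |h(y)| ≤ C₀ (1+|y|)^{−(N+2s)} for almost every y for some C₀ > 0, and is orthogonal to the rescaled dilation kernel: ∫_{ℝ^N} h(y) · μ^{−(N−2s)/2} v_{N+1}((y−ξ)/μ) dy = 0, where v_{N+1}(z) = z·∇U(z) + ((N−2s)/2) U(z). Then h is also orthogonal to the translation kernel in the first coordinate: ∫_{ℝ^N} h(y) ∂w_{μ,ξ}/∂y₁(y) dy = 0. -/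
open MeasureTheory Real ENNReal

noncomputable section

/-- The standard bubble `U(y) = c (1/(1+|y|²))^{(N-2s)/2}`. -/
def bubble (N : ℕ) (s c : ℝ) (y : EuclideanSpace ℝ (Fin N)) : ℝ :=
  c * (1 / (1 + ‖y‖ ^ 2)) ^ (((N : ℝ) - 2 * s) / 2)

/-- Rescaled, translated bubble `w_{μ,ξ}(y) = μ^{-(N-2s)/2} U((y-ξ)/μ)`. -/
def wBubble (N : ℕ) (s c μ : ℝ) (ξ y : EuclideanSpace ℝ (Fin N)) : ℝ :=
  μ ^ (-(((N : ℝ) - 2 * s) / 2)) * bubble N s c (μ⁻¹ • (y - ξ))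

/-- The dilation kernel element `v_{N+1}(z) = z·∇U(z) + ((N-2s)/2) U(z)`. -/
def vDil (N : ℕ) (s c : ℝ) (z : EuclideanSpace ℝ (Fin N)) : ℝ :=
  fderiv ℝ (bubble N s c) z z + (((N : ℝ) - 2 * s) / 2) * bubble N s c z

open Module in
/-- Change of variables under the inversion in the unit sphere. -/
theorem integral_inversion {E : Type*} [NormedAddCommGroup E] [InnerProductSpace ℝ E]
    [FiniteDimensional ℝ E] [Nontrivial E] [MeasurableSpace E] [BorelSpace E] (f : E → ℝ) :
    ∫ y : E, f y =
      ∫ y : E, ((‖y‖ ^ 2)⁻¹) ^ finrank ℝ E * f ((‖y‖ ^ 2)⁻¹ • y) := by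
  have hinv (y : E) : EuclideanGeometry.inversion 0 1 y = (‖y‖ ^ 2)⁻¹ • y := by
    simp [EuclideanGeometry.inversion]
  have himage : EuclideanGeometry.inversion (0 : E) 1 '' {0}ᶜ = {0}ᶜ := by
    rw [Set.image_compl_eq (EuclideanGeometry.inversion_bijective 0 one_ne_zero)]
    simp
  have hderiv : ∀ y ∈ ({0}ᶜ : Set E), HasFDerivWithinAt (EuclideanGeometry.inversion (0 : E) 1)
      ((1 / dist y 0) ^ 2 • ((Submodule.span ℝ {y - 0})ᗮ.reflection : E →L[ℝ] E)) {0}ᶜ y :=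
    fun y hy => (EuclideanGeometry.hasFDerivAt_inversion hy).hasFDerivWithinAt
  have hcov := integral_image_eq_integral_abs_det_fderiv_smul (volume : Measure E)
    (measurableSet_singleton (0 : E)).compl hderiv
    (EuclideanGeometry.inversion_injective (0 : E) one_ne_zero).injOn f
  have hae : ∀ᵐ y : E, y ∈ ({0}ᶜ : Set E) := compl_mem_ae_iff.2 (measure_singleton 0)
  rw [himage, Measure.restrict_eq_self_of_ae_mem hae] at hcov
  rw [hcov]
  congr 1 with y
  have hdet : (((Submodule.span ℝ {y - 0})ᗮ.reflection : E →L[ℝ] E)).det =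
      (-1) ^ finrank ℝ (Submodule.span ℝ {y - 0})ᗮᗮ :=
    Submodule.det_reflection _
  rw [hinv, ContinuousLinearMap.det, ContinuousLinearMap.toLinearMap_smul, LinearMap.det_smul,
    ← ContinuousLinearMap.det, hdet, abs_mul, abs_pow (-1)]
  simp

/-- The quadratic weight `1 + |y|² - 2⟨y, ξ⟩`, which is `μ² + |y - ξ|²` when `μ² + |ξ|² = 1`. -/
def kelvinWeight {E : Type*} [NormedAddCommGroup E] [InnerProductSpace ℝ E] (ξ y : E) : ℝ :=
  1 + ‖y‖ ^ 2 - 2 * inner ℝ y ξ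

section kelvinWeight

variable {E : Type*} [NormedAddCommGroup E] [InnerProductSpace ℝ E]

theorem kelvinWeight_eq {μ : ℝ} {ξ : E} (hξ : μ ^ 2 + ‖ξ‖ ^ 2 = 1) (y : E) :
    kelvinWeight ξ y = μ ^ 2 + ‖y - ξ‖ ^ 2 := by
  rw [kelvinWeight, norm_sub_sq_real]
  linarith

theorem kelvinWeight_lower_bound (ξ y : E) :
    (1 - ‖ξ‖) * (1 + ‖y‖ ^ 2) ≤ kelvinWeight ξ y := by
  have h1 := real_inner_le_norm y ξ
  have h2 : 0 ≤ ‖ξ‖ * (1 - ‖y‖) ^ 2 := by positivity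
  rw [kelvinWeight]
  nlinarith

theorem kelvinWeight_inversion (ξ : E) {y : E} (hy : y ≠ 0) :
    kelvinWeight ξ ((‖y‖ ^ 2)⁻¹ • y) = (‖y‖ ^ 2)⁻¹ * kelvinWeight ξ y := by
  have : ‖y‖ ≠ 0 := norm_ne_zero_iff.2 hy
  simp only [kelvinWeight, norm_smul, real_inner_smul_left, norm_inv, norm_pow, norm_norm]
  field_simp
  ring

theorem continuous_kelvinWeight (ξ : E) : Continuous (kelvinWeight ξ) := by
  unfold kelvinWeight
  fun_prop

variable [MeasurableSpace E] [BorelSpace E] [FiniteDimensional ℝ E]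

/-- An integrable function stays integrable after multiplication by a kernel
`kelvinWeight ^ (-(a + 1)) * g` with `g` dominated by `kelvinWeight`. -/
theorem MeasureTheory.Integrable.mul_kelvinWeight_rpow {μ a M : ℝ} (hμ : 0 < μ) (ha : 0 ≤ a) {ξ : E}
    (hξ : μ ^ 2 + ‖ξ‖ ^ 2 = 1) {h g : E → ℝ} (hh : Integrable h) (hg : Continuous g)
    (hgM : ∀ y, |g y| ≤ M * kelvinWeight ξ y) :
    Integrable fun y => h y * (kelvinWeight ξ y ^ (-(a + 1)) * g y) := by
  have hlow (y : E) : μ ^ 2 ≤ kelvinWeight ξ y := by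
    rw [kelvinWeight_eq hξ]
    nlinarith [sq_nonneg ‖y - ξ‖]
  have hpos (y : E) : 0 < kelvinWeight ξ y := lt_of_lt_of_le (by positivity) (hlow y)
  have hM : 0 ≤ M := by
    have := (abs_nonneg _).trans (hgM 0)
    exact nonneg_of_mul_nonneg_left this (hpos 0)
  refine hh.mul_bdd (c := M * (μ ^ 2) ^ (-a)) ?_ (Filter.Eventually.of_forall fun y => ?_)
  · exact (((continuous_kelvinWeight ξ).rpow_const
      fun y => Or.inl (hpos y).ne').mul hg).aestronglyMeasurable
  · rw [norm_mul, norm_of_nonneg (rpow_nonneg (hpos y).le _), norm_eq_abs]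
    calc kelvinWeight ξ y ^ (-(a + 1)) * |g y|
        ≤ kelvinWeight ξ y ^ (-(a + 1)) * (M * kelvinWeight ξ y) :=
          mul_le_mul_of_nonneg_left (hgM y) (rpow_nonneg (hpos y).le _)
      _ = M * kelvinWeight ξ y ^ (-a) := by
          rw [show -a = -(a + 1) + 1 by ring, rpow_add_one (hpos y).ne']
          ring
      _ ≤ M * (μ ^ 2) ^ (-a) :=
          mul_le_mul_of_nonneg_left
            (rpow_le_rpow_of_nonpos (by positivity) (hlow y) (by linarith)) hM

open Module in
/-- A function satisfying the Kelvin relation is orthogonal to the kernel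
`(1 + |y|² - 2⟨y, ξ⟩)^{-(N-2s)/2-1} (1 - |y|²)`, which is odd under the Kelvin transform. -/
theorem integral_kelvin_mul_eq_zero [Nontrivial E] {μ s : ℝ} (hμ : 0 < μ) {ξ : E}
    (hξ : μ ^ 2 + ‖ξ‖ ^ 2 = 1) {h : E → ℝ}
    (hkel : ∀ᵐ y : E, y ≠ 0 →
      h y = ‖y‖ ^ (-((finrank ℝ E : ℝ) + 2 * s)) * h ((‖y‖ ^ 2)⁻¹ • y)) :
    ∫ y : E, h y * (kelvinWeight ξ y ^ (-(((finrank ℝ E : ℝ) - 2 * s) / 2 + 1)) *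
      (1 - ‖y‖ ^ 2)) = 0 := by
  refine self_eq_neg.1 ?_
  conv_lhs => rw [integral_inversion]
  rw [← integral_neg]
  refine integral_congr_ae ?_
  filter_upwards [hkel, compl_mem_ae_iff.2 (measure_singleton (0 : E))] with y hy hy0
  have hy0 : y ≠ 0 := hy0
  have hn : 0 < ‖y‖ := norm_pos_iff.2 hy0
  have hpos : 0 < kelvinWeight ξ y := by
    rw [kelvinWeight_eq hξ]
    positivity
  rw [hy hy0, kelvinWeight_inversion ξ hy0, mul_rpow (by positivity) hpos.le,
    norm_smul, norm_inv, norm_pow, norm_norm]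
  set n := finrank ℝ E
  have hone : 1 - ((‖y‖ ^ 2)⁻¹ * ‖y‖) ^ 2 = -(‖y‖ ^ 2)⁻¹ * (1 - ‖y‖ ^ 2) := by
    field_simp
    ring
  have hpow : ((‖y‖ ^ 2)⁻¹) ^ n * ((‖y‖ ^ 2)⁻¹) ^ (-(((n : ℝ) - 2 * s) / 2 + 1)) * (‖y‖ ^ 2)⁻¹ =
      ‖y‖ ^ (-((n : ℝ) + 2 * s)) := by
    have hsq : (‖y‖ ^ 2)⁻¹ = ‖y‖ ^ (-2 : ℝ) := by
      rw [rpow_neg hn.le, Real.rpow_two]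
    rw [hsq, ← Real.rpow_natCast, ← rpow_mul hn.le, ← rpow_mul hn.le, ← rpow_add hn, ← rpow_add hn]
    congr 1
    ring
  rw [hone, ← hpow]
  ring

end kelvinWeight

theorem hasFDerivAt_bubble (N : ℕ) (s c : ℝ) (z : EuclideanSpace ℝ (Fin N)) :
    HasFDerivAt (bubble N s c)
      ((-(((N : ℝ) - 2 * s) * c) * (1 + ‖z‖ ^ 2) ^ (-(((N : ℝ) - 2 * s) / 2 + 1))) •
        innerSL ℝ z) z := by
  have hpos (y : EuclideanSpace ℝ (Fin N)) : 0 < 1 + ‖y‖ ^ 2 := by positivity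
  have heq : bubble N s c = fun y => c * (1 + ‖y‖ ^ 2) ^ (-(((N : ℝ) - 2 * s) / 2)) := by
    funext y
    rw [bubble, one_div, inv_rpow (hpos y).le, rpow_neg (hpos y).le]
  rw [heq]
  have h1 : HasFDerivAt (fun y : EuclideanSpace ℝ (Fin N) => 1 + ‖y‖ ^ 2)
      (2 • innerSL ℝ z) z := by
    simpa using (hasStrictFDerivAt_norm_sq z).hasFDerivAt.const_add 1
  refine ((h1.rpow_const (Or.inl (hpos z).ne')).const_mul c).congr_fderiv ?_
  ext v
  simp only [smul_apply, smul_eq_mul, nsmul_eq_mul, innerSL_apply_apply]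
  rw [show -(((N : ℝ) - 2 * s) / 2) - 1 = -(((N : ℝ) - 2 * s) / 2 + 1) by ring]
  push_cast
  ring

theorem vDil_eq (N : ℕ) (s c : ℝ) (z : EuclideanSpace ℝ (Fin N)) :
    vDil N s c z = ((N : ℝ) - 2 * s) / 2 * c *
      ((1 + ‖z‖ ^ 2) ^ (-(((N : ℝ) - 2 * s) / 2 + 1)) * (1 - ‖z‖ ^ 2)) := by
  have hpos : 0 < 1 + ‖z‖ ^ 2 := by positivity
  have hb : bubble N s c z =
      c * ((1 + ‖z‖ ^ 2) ^ (-(((N : ℝ) - 2 * s) / 2 + 1)) * (1 + ‖z‖ ^ 2)) := by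
    rw [← rpow_add_one hpos.ne', bubble, one_div, inv_rpow hpos.le, ← rpow_neg hpos.le]
    congr 2
    ring
  rw [vDil, (hasFDerivAt_bubble N s c z).fderiv, hb]
  simp only [smul_apply, smul_eq_mul, innerSL_apply_apply,
    real_inner_self_eq_norm_sq]
  ring

theorem fderiv_wBubble_apply (N : ℕ) (s c μ : ℝ) (ξ y v : EuclideanSpace ℝ (Fin N)) :
    fderiv ℝ (wBubble N s c μ ξ) y v =
      -(((N : ℝ) - 2 * s) * c) * μ ^ (-(((N : ℝ) - 2 * s) / 2)) * μ⁻¹ ^ 2 *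
        ((1 + ‖μ⁻¹ • (y - ξ)‖ ^ 2) ^ (-(((N : ℝ) - 2 * s) / 2 + 1)) * inner ℝ (y - ξ) v) := by
  have h1 : HasFDerivAt (fun x => μ⁻¹ • (x - ξ))
      (μ⁻¹ • ContinuousLinearMap.id ℝ (EuclideanSpace ℝ (Fin N))) y :=
    ((hasFDerivAt_id y).sub_const ξ).const_smul μ⁻¹
  have h2 : HasFDerivAt (wBubble N s c μ ξ) _ y :=
    ((hasFDerivAt_bubble N s c (μ⁻¹ • (y - ξ))).comp y h1).const_mul _
  rw [h2.fderiv]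
  simp only [smul_apply, ContinuousLinearMap.comp_apply, smul_eq_mul,
    innerSL_apply_apply, real_inner_smul_left, ContinuousLinearMap.id_apply, real_inner_smul_right]
  ring

theorem one_add_norm_smul_sub_sq {E : Type*} [NormedAddCommGroup E] [InnerProductSpace ℝ E]
    {μ : ℝ} (hμ : 0 < μ) {ξ : E} (hξ : μ ^ 2 + ‖ξ‖ ^ 2 = 1) (y : E) :
    1 + ‖μ⁻¹ • (y - ξ)‖ ^ 2 = μ⁻¹ ^ 2 * kelvinWeight ξ y := by
  rw [kelvinWeight_eq hξ, norm_smul, norm_inv, norm_of_nonneg hμ.le]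
  field_simp

/-- If `h` satisfies the Kelvin relation, decays like `(1+|y|)^{-(N+2s)}`, and is orthogonal
to the rescaled dilation kernel at `(μ, ξ)` with `μ² + |ξ|² = 1`, then `h` is also
orthogonal to `∂w_{μ,ξ}/∂y₁`. -/
theorem kelvin_orthogonal_dilation_implies_orthogonal_translation
    (N : ℕ) (hN : 3 ≤ N) (s : ℝ) (hs : s ∈ Set.Ioo (0 : ℝ) 1) (c : ℝ) (hc : 0 < c)
    (μ : ℝ) (hμ : μ ∈ Set.Ioo (0 : ℝ) 1)
    (ξ : EuclideanSpace ℝ (Fin N))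
    (hξ : ξ = (EuclideanSpace.equiv (Fin N) ℝ).symm
      (fun i => if (i : ℕ) = 0 then Real.sqrt (1 - μ ^ 2) else 0))
    (h : EuclideanSpace ℝ (Fin N) → ℝ) (hmeas : Measurable h)
    (hkel : ∀ᵐ y : EuclideanSpace ℝ (Fin N), y ≠ 0 →
      h y = ‖y‖ ^ (-((N : ℝ) + 2 * s)) * h ((‖y‖ ^ 2)⁻¹ • y))
    (C₀ : ℝ) (hC₀ : 0 < C₀)
    (hdecay : ∀ᵐ y : EuclideanSpace ℝ (Fin N),
      |h y| ≤ C₀ * (1 + ‖y‖) ^ (-((N : ℝ) + 2 * s)))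
    (horth : (∫ y : EuclideanSpace ℝ (Fin N),
      h y * (μ ^ (-(((N : ℝ) - 2 * s) / 2)) * vDil N s c (μ⁻¹ • (y - ξ)))) = 0) :
    (∫ y : EuclideanSpace ℝ (Fin N),
      h y * fderiv ℝ (wBubble N s c μ ξ) y (EuclideanSpace.single ⟨0, by omega⟩ 1)) = 0 := by
  obtain ⟨hμ0, hμ1⟩ := hμ
  obtain ⟨hs0, hs1⟩ := hs
  have hN' : (3 : ℝ) ≤ N := by exact_mod_cast hN
  have : Nonempty (Fin N) := ⟨⟨0, by omega⟩⟩
  set e : EuclideanSpace ℝ (Fin N) := EuclideanSpace.single ⟨0, by omega⟩ 1 with he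
  set r := Real.sqrt (1 - μ ^ 2) with hr
  have hμsq : 0 < 1 - μ ^ 2 := by nlinarith
  have hr0 : 0 < r := Real.sqrt_pos.2 hμsq
  have hrsq : r ^ 2 = 1 - μ ^ 2 := Real.sq_sqrt hμsq.le
  have hr1 : r < 1 := by nlinarith [sq_pos_of_pos hμ0]
  have hξe : ξ = r • e := by
    ext i
    simp [hξ, he, Fin.ext_iff]
  have hnorm : ‖ξ‖ = r := by
    rw [hξe, norm_smul, he, PiLp.norm_single, norm_of_nonneg hr0.le]
    simp
  have hone : μ ^ 2 + ‖ξ‖ ^ 2 = 1 := by rw [hnorm, hrsq]; ring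
  set a := ((N : ℝ) - 2 * s) / 2 with ha
  have ha0 : 0 < a := by rw [ha]; linarith
  have hNa : (N : ℝ) - 2 * s = 2 * a := by rw [ha]; ring
  have hpos (y : EuclideanSpace ℝ (Fin N)) : 0 < kelvinWeight ξ y := by
    rw [kelvinWeight_eq hone]
    positivity
  have hh : Integrable h := by
    refine ((integrable_one_add_norm (E := EuclideanSpace ℝ (Fin N))
      (r := (N : ℝ) + 2 * s) ?_).const_mul C₀).mono' hmeas.aestronglyMeasurable hdecay
    rw [finrank_euclideanSpace_fin]
    linarith
  have hodd : ∫ y, h y * (kelvinWeight ξ y ^ (-(a + 1)) * (1 - ‖y‖ ^ 2)) = 0 := by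
    have := integral_kelvin_mul_eq_zero (s := s) hμ0 hone (h := h)
      (by simpa only [finrank_euclideanSpace_fin] using hkel)
    simpa only [finrank_euclideanSpace_fin] using this
  have hdil : ∫ y, h y * (kelvinWeight ξ y ^ (-(a + 1)) * (μ ^ 2 - ‖y - ξ‖ ^ 2)) = 0 := by
    have hk : μ ^ (-a) * (a * c) * (μ⁻¹ ^ 2) ^ (-(a + 1)) * μ⁻¹ ^ 2 ≠ 0 := by positivity
    refine (mul_eq_zero.1 ?_).resolve_left hk
    rw [← horth, ← integral_const_mul]
    congr 1 with y
    rw [vDil_eq, ← ha, one_add_norm_smul_sub_sq hμ0 hone, mul_rpow (by positivity) (hpos y).le,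
      norm_smul, norm_inv, norm_of_nonneg hμ0.le]
    field_simp
  have hint1 := hh.mul_kelvinWeight_rpow (M := (1 - r)⁻¹) hμ0 ha0.le hone
    (g := fun y => 1 - ‖y‖ ^ 2) (by fun_prop) fun y => by
      have h1 := kelvinWeight_lower_bound ξ y
      rw [hnorm] at h1
      rw [inv_mul_eq_div, le_div_iff₀ (by linarith)]
      refine le_trans ?_ h1
      rw [mul_comm]
      refine mul_le_mul_of_nonneg_left ?_ (by linarith)
      rw [abs_le]
      constructor <;> nlinarith [sq_nonneg ‖y‖]
  have hint2 := hh.mul_kelvinWeight_rpow (M := 1) hμ0 ha0.le hone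
    (g := fun y => μ ^ 2 - ‖y - ξ‖ ^ 2) (by fun_prop) fun y => by
      rw [kelvinWeight_eq hone, abs_le]
      constructor <;> nlinarith [sq_nonneg ‖y - ξ‖, sq_nonneg μ]
  have htrans : ∫ y, h y * (kelvinWeight ξ y ^ (-(a + 1)) * inner ℝ (y - ξ) e) = 0 := by
    refine (mul_eq_zero.1 ?_).resolve_left (show 2 * r ≠ 0 by positivity)
    rw [← integral_const_mul]
    trans ∫ y, (h y * (kelvinWeight ξ y ^ (-(a + 1)) * (μ ^ 2 - ‖y - ξ‖ ^ 2)) -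
      h y * (kelvinWeight ξ y ^ (-(a + 1)) * (1 - ‖y‖ ^ 2)))
    · congr 1 with y
      have h1 : r * inner ℝ (y - ξ) e = inner ℝ y ξ - ‖ξ‖ ^ 2 := by
        rw [← real_inner_smul_right, ← hξe, inner_sub_left, real_inner_self_eq_norm_sq]
      have h2 := norm_sub_sq_real y ξ
      rw [h2]
      linear_combination 2 * h y * kelvinWeight ξ y ^ (-(a + 1)) * h1 -
        h y * kelvinWeight ξ y ^ (-(a + 1)) * hone
    · rw [integral_sub hint2 hint1, hodd, hdil, sub_zero]
  rw [← mul_zero (-(2 * a * c) * μ ^ (-a) * μ⁻¹ ^ 2 * (μ⁻¹ ^ 2) ^ (-(a + 1))), ← htrans,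
    ← integral_const_mul]
  congr 1 with y
  rw [fderiv_wBubble_apply, ← ha, hNa, one_add_norm_smul_sub_sq hμ0 hone,
    mul_rpow (by positivity) (hpos y).le]
  ring

end
end

section
/- Let α = N − 2s (so α > 1 since N ≥ 3 and s ∈ (0,1)). Then the sequence a_k := k^{−α} Σ_{j=2}^{k} |ξ̂₁ − ξ̂_j|^{−α}, where ξ̂_j = (cos(2π(j−1)/k), sin(2π(j−1)/k), 0, …, 0) ∈ ℝ^N are k equally spaced points on the unit circle in the first two coordinates (equivalently, a_k = k^{−α} Σ_{j=1}^{k−1} (2 sin(πj/k))^{−α}), converges as k → ∞ to a strictly positive real number. -/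
open Real Filter Finset

noncomputable section

/-- The point `(cos θ, sin θ, 0, …, 0)` on the unit circle of the first two
coordinates of `ℝ^N = ℝ² × ℝ^{N-2}`. -/
def circPt (N : ℕ) (θ : ℝ) : EuclideanSpace ℝ (Fin N) :=
  (EuclideanSpace.equiv (Fin N) ℝ).symm
    (fun i => if (i : ℕ) = 0 then Real.cos θ
      else if (i : ℕ) = 1 then Real.sin θ else 0)

/-- The `j`-th root of unity `ξ̂_j = (cos(2π(j-1)/k), sin(2π(j-1)/k), 0, …, 0)`. -/
def xiHat (N : ℕ) (k j : ℕ) : EuclideanSpace ℝ (Fin N) :=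
  circPt N (2 * Real.pi * ((j : ℝ) - 1) / k)

/-- The chord between two points of the unit circle. -/
lemma norm_circPt_sub (n : ℕ) (a b : ℝ) :
    ‖circPt (n + 2) a - circPt (n + 2) b‖ = 2 * |Real.sin ((b - a) / 2)| := by
  rw [EuclideanSpace.norm_eq, Fin.sum_univ_succ, Fin.sum_univ_succ]
  have hsq : (Real.cos a - Real.cos b) ^ 2 + (Real.sin a - Real.sin b) ^ 2
      = (2 * |Real.sin ((b - a) / 2)|) ^ 2 := by
    rw [mul_pow, sq_abs, Real.sin_sq_eq_half_sub, mul_div_cancel₀ _ two_ne_zero, Real.cos_sub]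
    nlinarith [Real.sin_sq_add_cos_sq a, Real.sin_sq_add_cos_sq b]
  rw [← Real.sqrt_sq (by positivity : 0 ≤ 2 * |Real.sin ((b - a) / 2)|), ← hsq]
  simp [circPt]

lemma norm_xiHat_sub (n k i : ℕ) :
    ‖xiHat (n + 2) k 1 - xiHat (n + 2) k (i + 2)‖
      = 2 * |Real.sin (π * ((i + 1 : ℕ) : ℝ) / k)| := by
  rw [xiHat, xiHat, norm_circPt_sub]
  congr 3
  push_cast
  ring

/-- The rescaled interaction `(k |ξ̂₁ - ξ̂_{j+1}|)^{-α}`. -/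
def chordTerm (α : ℝ) (k j : ℕ) : ℝ := (2 * k * Real.sin (π * j / k)) ^ (-α)

/-- A weight with `w(j) + w(k - j) = 1`, supported on `j ≤ k / 2`. -/
def halfWeight (k j : ℕ) : ℝ := if 2 * j < k then 1 else if 2 * j = k then 1 / 2 else 0

lemma halfWeight_add_reflect {k j : ℕ} (hj : j ≤ k) :
    halfWeight k j + halfWeight k (k - j) = 1 := by
  unfold halfWeight
  split_ifs <;> first | omega | norm_num

lemma halfWeight_nonneg (k j : ℕ) : 0 ≤ halfWeight k j := by
  unfold halfWeight
  split_ifs <;> norm_num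

lemma halfWeight_le_one (k j : ℕ) : halfWeight k j ≤ 1 := by
  unfold halfWeight
  split_ifs <;> norm_num

lemma halfWeight_eq_zero {k j : ℕ} (h : k < 2 * j) : halfWeight k j = 0 := by
  unfold halfWeight
  split_ifs <;> first | omega | rfl

lemma chordTerm_reflect (α : ℝ) {k j : ℕ} (hj : j ≤ k) (hk : 0 < k) :
    chordTerm α k (k - j) = chordTerm α k j := by
  have hk' : (k : ℝ) ≠ 0 := by positivity
  rw [chordTerm, chordTerm, Nat.cast_sub hj,
    show π * ((k : ℝ) - j) / k = π - π * j / k by field_simp, Real.sin_pi_sub]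

lemma scaled_sum_eq (n k : ℕ) {α : ℝ} (hα : α ≠ 0) (hk : 0 < k) :
    (k : ℝ) ^ (-α) * ∑ j ∈ Finset.Icc 2 k, ‖xiHat (n + 2) k 1 - xiHat (n + 2) k j‖ ^ (-α)
      = ∑ j ∈ Finset.range (k + 1), chordTerm α k j := by
  obtain ⟨m, rfl⟩ : ∃ m, k = m + 1 := ⟨k - 1, by omega⟩
  have hzero : chordTerm α (m + 1) 0 = 0 := by
    simp [chordTerm, Real.zero_rpow (neg_ne_zero.mpr hα)]
  have hlast : chordTerm α (m + 1) (m + 1) = 0 := by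
    rw [← chordTerm_reflect α le_rfl hk, Nat.sub_self, hzero]
  rw [Finset.sum_range_succ, hlast, Finset.sum_range_succ', hzero, add_zero, add_zero,
    ← Finset.Ico_add_one_right_eq_Icc, Finset.sum_Ico_eq_sum_range, Finset.mul_sum]
  refine Finset.sum_congr (by congr 1) fun i hi => ?_
  have him : i < m := by simpa using hi
  have hsin : 0 ≤ Real.sin (π * ((i + 1 : ℕ) : ℝ) / (m + 1 : ℕ)) := by
    apply Real.sin_nonneg_of_nonneg_of_le_pi (by positivity)
    rw [div_le_iff₀ (by positivity)]
    gcongr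
  rw [add_comm 2 i, norm_xiHat_sub, abs_of_nonneg hsin, chordTerm,
    ← Real.mul_rpow (by positivity) (by positivity)]
  congr 1
  ring

lemma sum_chordTerm_eq_tsum (α : ℝ) {k : ℕ} (hk : 0 < k) :
    ∑ j ∈ Finset.range (k + 1), chordTerm α k j
      = ∑' j, 2 * (halfWeight k j * chordTerm α k j) := by
  rw [tsum_eq_sum (s := Finset.range (k + 1)), ← Finset.mul_sum, two_mul]
  · nth_rewrite 2 [← Finset.sum_flip]
    rw [← Finset.sum_add_distrib]
    refine Finset.sum_congr rfl fun j hj => ?_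
    have hjk : j ≤ k := by simpa [Nat.lt_succ_iff] using hj
    rw [chordTerm_reflect α hjk hk, ← add_mul, add_comm (halfWeight k (k - j)), halfWeight_add_reflect hjk,
      one_mul]
  · intro j hj
    have : k < 2 * j := by
      simp only [Finset.mem_range, not_lt] at hj
      omega
    rw [halfWeight_eq_zero this, zero_mul, mul_zero]

/-- Jordan's inequality bounds the weighted terms by a convergent `p`-series. -/
lemma halfWeight_mul_chordTerm_le {α : ℝ} (hα : 0 < α) {k : ℕ} (hk : 0 < k) (j : ℕ) :
    ‖2 * (halfWeight k j * chordTerm α k j)‖ ≤ 2 * (j : ℝ) ^ (-α) := by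
  by_cases hjk : k < 2 * j
  · rw [halfWeight_eq_zero hjk, zero_mul, mul_zero, norm_zero]
    positivity
  rcases Nat.eq_zero_or_pos j with rfl | hj
  · simp [chordTerm, Real.zero_rpow (neg_ne_zero.mpr hα.ne')]
  have hk' : (0 : ℝ) < k := by positivity
  have hle : 2 * (j : ℝ) ≤ k := by exact_mod_cast not_lt.mp hjk
  have hjordan : 2 / π * (π * j / k) ≤ Real.sin (π * j / k) := by
    apply Real.mul_le_sin (by positivity)
    rw [div_le_div_iff₀ hk' two_pos]
    nlinarith [Real.pi_pos]
  have hbase : (j : ℝ) ≤ 2 * k * Real.sin (π * j / k) := by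
    calc (j : ℝ) ≤ 4 * j := by linarith [(Nat.cast_nonneg j : (0 : ℝ) ≤ j)]
      _ = 2 * k * (2 / π * (π * j / k)) := by field_simp; norm_num
      _ ≤ _ := by gcongr
  have hj' : (0 : ℝ) < j := by positivity
  have hterm : chordTerm α k j ≤ (j : ℝ) ^ (-α) :=
    Real.rpow_le_rpow_of_nonpos hj' hbase (by linarith)
  have hnonneg : 0 ≤ chordTerm α k j := Real.rpow_nonneg (hj'.le.trans hbase) _
  have hw := halfWeight_nonneg k j
  rw [Real.norm_of_nonneg (by positivity)]
  have := mul_le_of_le_one_left hnonneg (halfWeight_le_one k j)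
  linarith

lemma tendsto_mul_sin_div (c : ℝ) :
    Tendsto (fun k : ℕ => (k : ℝ) * Real.sin (c / k)) atTop (nhds c) := by
  have hderiv : HasDerivAt (fun x => Real.sin (c * x)) c 0 := by
    simpa using ((hasDerivAt_id (0 : ℝ)).const_mul c).sin
  have h := (hasDerivAt_iff_tendsto_slope_zero.mp hderiv).comp
    (tendsto_inv_atTop_nhdsGT_zero.mono_right (nhdsWithin_mono _ fun _ hx => ne_of_gt hx)
      |>.comp tendsto_natCast_atTop_atTop)
  simpa [Function.comp_def, div_eq_mul_inv] using h

lemma tendsto_halfWeight_mul_chordTerm {α : ℝ} (hα : α ≠ 0) (j : ℕ) :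
    Tendsto (fun k : ℕ => 2 * (halfWeight k j * chordTerm α k j)) atTop
      (nhds (2 * (2 * π * j) ^ (-α))) := by
  rcases Nat.eq_zero_or_pos j with rfl | hj
  · simp [chordTerm, Real.zero_rpow (neg_ne_zero.mpr hα)]
  have hbase : Tendsto (fun k : ℕ => 2 * (k : ℝ) * Real.sin (π * j / k)) atTop
      (nhds (2 * π * j)) := by
    simpa [mul_assoc] using (tendsto_mul_sin_div (π * j)).const_mul 2
  have hpos : 2 * π * (j : ℝ) ≠ 0 := by positivity
  refine ((hbase.rpow_const (Or.inl hpos)).const_mul 2).congr' ?_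
  filter_upwards [eventually_gt_atTop (2 * j)] with k hk
  simp [halfWeight, hk, chordTerm]

/-- The sequence `a_k = k^{-α} ∑_{j=2}^k |ξ̂₁ - ξ̂_j|^{-α}`, `α = N - 2s`, converges to a
strictly positive limit as `k → ∞`. -/
theorem interaction_sum_converges
    (N : ℕ) (hN : 3 ≤ N) (s : ℝ) (hs : s ∈ Set.Ioo (0 : ℝ) 1) :
    ∃ L : ℝ, 0 < L ∧
      Tendsto (fun k : ℕ => (k : ℝ) ^ (-((N : ℝ) - 2 * s)) *
          ∑ j ∈ Finset.Icc 2 k, ‖xiHat N k 1 - xiHat N k j‖ ^ (-((N : ℝ) - 2 * s)))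
        atTop (nhds L) := by
  obtain ⟨n, rfl⟩ : ∃ n, N = n + 2 := ⟨N - 2, by omega⟩
  set α : ℝ := ((n + 2 : ℕ) : ℝ) - 2 * s
  have hα : 1 < α := by
    have : (3 : ℝ) ≤ ((n + 2 : ℕ) : ℝ) := by exact_mod_cast hN
    linarith [hs.2]
  have hα0 : α ≠ 0 := by positivity
  have hsummable : Summable fun j : ℕ => (j : ℝ) ^ (-α) :=
    Real.summable_nat_rpow.mpr (by linarith)
  have hlim : Summable fun j : ℕ => 2 * (2 * π * (j : ℝ)) ^ (-α) := by
    have hsplit (j : ℕ) : (2 * π * (j : ℝ)) ^ (-α) = (2 * π) ^ (-α) * (j : ℝ) ^ (-α) :=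
      Real.mul_rpow (by positivity) (by positivity)
    simpa only [hsplit] using (hsummable.mul_left _).mul_left 2
  refine ⟨∑' j : ℕ, 2 * (2 * π * (j : ℝ)) ^ (-α),
    hlim.tsum_pos (fun j => by positivity) 1 (by positivity), ?_⟩
  refine (tendsto_tsum_of_dominated_convergence (hsummable.mul_left 2)
    (tendsto_halfWeight_mul_chordTerm hα0) ?_).congr' ?_
  · filter_upwards [eventually_gt_atTop 0] with k hk j
    exact halfWeight_mul_chordTerm_le (by linarith) hk j
  · filter_upwards [eventually_gt_atTop 0] with k hk
    rw [scaled_sum_eq n k hα0 hk, sum_chordTerm_eq_tsum α hk]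

end
end
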